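/- arXiv:1608.01833 — 3 statements merged into one kernel-verified Lean document; each statement's English description precedes it below -/
import Mathlib

section
/- Let φ : (S₁, μ₁) → (S₂, μ₂) be a measure-preserving map between σ-finite measure spaces, and let W ∈ L¹(S₂ × S₂, μ₂ × μ₂). Define the pull-back W^φ(x, y) := W(φ(x), φ(y)). Then the cut norm of W^φ on (S₁, μ₁) equals the cut norm of W on (S₂, μ₂). -/
open MeasureTheory Filter Topology

noncomputable def cutNorm {S : Type*} [MeasurableSpace S] (μ : Measure S)
    (F : S × S → ℝ) : ℝ :=
  ⨆ TU : {TU : Set S × Set S // MeasurableSet TU.1 ∧ MeasurableSet TU.2},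
    |∫ p in TU.1.1 ×ˢ TU.1.2, F p ∂(μ.prod μ)|

theorem cut_aux {S : Type*} [MeasurableSpace S] (μ ν : Measure S) (hν : ν ≤ μ)
    (h : S → ℝ) (hh : Integrable h μ) :
    ∃ A, MeasurableSet A ∧ ∫ x, h x ∂ν ≤ ∫ x in A, h x ∂μ := by
  obtain ⟨k, hk, hae⟩ := hh.1
  have hki : Integrable k μ := hh.congr hae
  have hA : MeasurableSet {x | 0 < k x} := measurableSet_lt measurable_const hk.measurable
  refine ⟨{x | 0 < k x}, hA, ?_⟩
  have haν : h =ᵐ[ν] k := (Measure.absolutelyContinuous_of_le hν).ae_eq hae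
  rw [integral_congr_ae haν, integral_congr_ae (ae_restrict_of_ae hae)]
  calc ∫ x, k x ∂ν ≤ ∫ x, Set.indicator {x | 0 < k x} k x ∂ν := by
        apply integral_mono (hki.mono_measure hν) ((hki.mono_measure hν).indicator hA)
        intro x
        by_cases hx : 0 < k x
        · simp [Set.indicator, hx]
        · simp [Set.indicator, hx]; linarith
    _ = ∫ x in {x | 0 < k x}, k x ∂ν := integral_indicator hA
    _ ≤ ∫ x in {x | 0 < k x}, k x ∂μ := by
        apply integral_mono_measure (Measure.restrict_mono le_rfl hν) _ hki.integrableOn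
        exact (ae_restrict_iff' hA).2 (ae_of_all _ fun x hx => le_of_lt hx)

theorem cut_prod_mono {S : Type*} [MeasurableSpace S] {μ ν μ' ν' : Measure S} [SFinite μ]
    [SFinite ν] [SFinite μ'] [SFinite ν'] (h : ν ≤ μ) (h' : ν' ≤ μ') :
    ν.prod ν' ≤ μ.prod μ' := by
  refine Measure.le_iff.2 fun s hs => ?_
  rw [Measure.prod_apply hs, Measure.prod_apply hs]
  exact lintegral_mono' h fun x => h' _

theorem cut_aux2 {S : Type*} [MeasurableSpace S] (μ ν ν' : Measure S) [SigmaFinite μ]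
    [SFinite ν] [SFinite ν'] (hν : ν ≤ μ) (hν' : ν' ≤ μ)
    (W : S × S → ℝ) (hW : Integrable W (μ.prod μ)) :
    ∃ A B, MeasurableSet A ∧ MeasurableSet B ∧
      ∫ p, W p ∂(ν.prod ν') ≤ ∫ p in A ×ˢ B, W p ∂(μ.prod μ) := by
  have h1 : Integrable W (μ.prod ν') := hW.mono_measure (cut_prod_mono le_rfl hν')
  obtain ⟨A, hA, hA'⟩ := cut_aux μ ν hν _ h1.integral_prod_left
  have h2 : Integrable W ((μ.restrict A).prod μ) :=
    hW.mono_measure (cut_prod_mono Measure.restrict_le_self le_rfl)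
  obtain ⟨B, hB, hB'⟩ := cut_aux μ ν' hν' _ h2.integral_prod_right
  refine ⟨A, B, hA, hB, ?_⟩
  rw [← integral_prod _ (hW.mono_measure (cut_prod_mono hν hν')),
    ← integral_prod _ (hW.mono_measure (cut_prod_mono Measure.restrict_le_self hν'))] at hA'
  rw [← integral_prod_symm _ (hW.mono_measure (cut_prod_mono Measure.restrict_le_self hν')),
    ← integral_prod_symm _ (hW.mono_measure
      (cut_prod_mono Measure.restrict_le_self Measure.restrict_le_self)),
    Measure.prod_restrict] at hB'
  exact hA'.trans hB'

theorem cut_bdd {S : Type*} [MeasurableSpace S] (μ : Measure S)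
    (W : S × S → ℝ) (hW : Integrable W (μ.prod μ)) :
    BddAbove (Set.range fun TU : {TU : Set S × Set S // MeasurableSet TU.1 ∧ MeasurableSet TU.2} =>
      |∫ p in TU.1.1 ×ˢ TU.1.2, W p ∂(μ.prod μ)|) := by
  refine ⟨∫ p, |W p| ∂(μ.prod μ), ?_⟩
  rintro _ ⟨TU, rfl⟩
  exact abs_integral_le_integral_abs.trans
    (setIntegral_le_integral hW.abs (ae_of_all _ fun _ => abs_nonneg _))

theorem cutNorm_pullback {S₁ S₂ : Type*} [MeasurableSpace S₁] [MeasurableSpace S₂]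
    (μ₁ : Measure S₁) (μ₂ : Measure S₂) [SigmaFinite μ₁] [SigmaFinite μ₂]
    (φ : S₁ → S₂) (hφ : MeasurePreserving φ μ₁ μ₂)
    (W : S₂ × S₂ → ℝ) (hW : Integrable W (μ₂.prod μ₂)) :
    cutNorm μ₁ (fun p => W (φ p.1, φ p.2)) = cutNorm μ₂ W := by
  have key : ∀ T U : Set S₁,
      ∫ p in T ×ˢ U, W (φ p.1, φ p.2) ∂(μ₁.prod μ₁) =
        ∫ p, W p ∂(((μ₁.restrict T).map φ).prod ((μ₁.restrict U).map φ)) := by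
    intro T U
    have hle : ∀ T : Set S₁, (μ₁.restrict T).map φ ≤ μ₂ := fun T => by
      rw [← hφ.map_eq]; exact Measure.map_mono Measure.restrict_le_self hφ.measurable
    have hi := (hW.mono_measure (cut_prod_mono (hle T) (hle U))).1
    rw [Measure.map_prod_map _ _ hφ.measurable hφ.measurable] at hi ⊢
    rw [integral_map (hφ.measurable.prodMap hφ.measurable).aemeasurable hi,
      Measure.prod_restrict]
    rfl
  have hle : ∀ T : Set S₁, (μ₁.restrict T).map φ ≤ μ₂ := fun T => by
    rw [← hφ.map_eq]; exact Measure.map_mono Measure.restrict_le_self hφ.measurable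
  have hWφ : Integrable (fun p : S₁ × S₁ => W (φ p.1, φ p.2)) (μ₁.prod μ₁) :=
    (hφ.prod hφ).integrable_comp_of_integrable hW
  haveI : Nonempty {TU : Set S₂ × Set S₂ // MeasurableSet TU.1 ∧ MeasurableSet TU.2} :=
    ⟨⟨(∅, ∅), MeasurableSet.empty, MeasurableSet.empty⟩⟩
  unfold cutNorm
  apply le_antisymm
  · haveI : Nonempty {TU : Set S₁ × Set S₁ // MeasurableSet TU.1 ∧ MeasurableSet TU.2} :=
      ⟨⟨(∅, ∅), MeasurableSet.empty, MeasurableSet.empty⟩⟩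
    refine ciSup_le fun ⟨⟨T, U⟩, hT, hU⟩ => ?_
    simp only
    rw [key]
    refine abs_le'.2 ⟨?_, ?_⟩
    · obtain ⟨A, B, hA, hB, h⟩ := cut_aux2 μ₂ _ _ (hle T) (hle U) W hW
      exact (h.trans (le_abs_self _)).trans (le_ciSup (cut_bdd μ₂ W hW) ⟨(A, B), hA, hB⟩)
    · obtain ⟨A, B, hA, hB, h⟩ := cut_aux2 μ₂ _ _ (hle T) (hle U) (fun p => - W p) hW.neg
      rw [integral_neg, integral_neg] at h
      exact (h.trans (neg_le_abs _)).trans (le_ciSup (cut_bdd μ₂ W hW) ⟨(A, B), hA, hB⟩)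
  · refine ciSup_le fun ⟨⟨A, B⟩, hA, hB⟩ => ?_
    have := le_ciSup (cut_bdd μ₁ _ hWφ)
      ⟨(φ ⁻¹' A, φ ⁻¹' B), hφ.measurable hA, hφ.measurable hB⟩
    simp only at this ⊢
    rw [key, ← Measure.restrict_map hφ.measurable hA, ← Measure.restrict_map hφ.measurable hB,
      hφ.map_eq, Measure.prod_restrict] at this
    refine le_trans this (le_of_eq ?_)
    rfl
end

section
/- Let (S, μ) be a σ-finite measure space and let (Wₙ) be a sequence of symmetric integrable functions on S × S that is uniformly integrable (i.e., sup_n ∫|Wₙ| dμ² < ∞ and sup_n ∫_{|Wₙ|>B} |Wₙ| dμ² → 0 as B → ∞) and is a Cauchy sequence for the cut norm. Then there exists a symmetric integrable function V on S × S such that ‖Wₙ − V‖_□ → 0 as n → ∞. -/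
open MeasureTheory Filter Topology

theorem exists_ultra_lim {ι : Type*} (U : Ultrafilter ι) (u : ι → ENNReal) :
    ∃ a, Tendsto u U (𝓝 a) := by
  obtain ⟨a, -, ha⟩ := (isCompact_univ (X := ENNReal)).ultrafilter_le_nhds (U.map u) (by simp)
  exact ⟨a, ha⟩

theorem exists_limit_measure_on {X : Type*} [MeasurableSpace X] (μ : Measure X)
    (l : ℕ → Measure X)
    (U : Ultrafilter ℕ)
    (hUI : ∀ ε : ENNReal, 0 < ε → ∃ B : NNReal, ∀ n A, MeasurableSet A → l n A ≤ B * μ A + ε)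
    (L : Set X → ENNReal) (hL : ∀ A, Tendsto (fun n => l n A) U (𝓝 (L A)))
    (F : Set X) (hF : MeasurableSet F) (hFf : μ F < ⊤) :
    ∃ ν : Measure X, ∀ A, MeasurableSet A → ν A = L (A ∩ F) := by
  have hL0 : L ∅ = 0 := by
    have := hL ∅
    simp only [measure_empty] at this
    exact tendsto_nhds_unique this tendsto_const_nhds
  refine ⟨Measure.ofMeasurable (fun A _ => L (A ∩ F)) (by simpa using hL0) ?_, ?_⟩
  · intro A hA hd
    set T : ℕ → Set X := fun j => (⋃ i, A i) \ ⋃ i ∈ Finset.range j, A i with hT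
    have hPm : ∀ j, MeasurableSet (⋃ i ∈ Finset.range j, A i) := fun j =>
      Finset.measurableSet_biUnion _ fun i _ => hA i
    have hTm : ∀ j, MeasurableSet (T j) := fun j =>
      (MeasurableSet.iUnion hA).diff (hPm j)
    have h1 : ∀ j, L ((⋃ i, A i) ∩ F) = ∑ i ∈ Finset.range j, L (A i ∩ F) + L (T j ∩ F) := by
      intro j
      refine tendsto_nhds_unique (hL _) ?_
      refine Tendsto.congr ?_ ((tendsto_finsetSum (Finset.range j)
        (fun i _ => hL (A i ∩ F))).add (hL (T j ∩ F)))
      intro n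
      rw [← measure_biUnion_finset, ← measure_union]
      · congr 1
        ext x
        simp only [hT, Set.mem_union, Set.mem_iUnion, Set.mem_inter_iff, Set.mem_sdiff]
        grind
      · rw [Set.disjoint_left]
        intro x hx hx'
        simp only [hT, Set.mem_iUnion, Set.mem_inter_iff, Set.mem_sdiff] at hx hx'
        grind
      · exact (hTm j).inter hF
      · intro a _ b _ hab
        exact (hd hab).mono Set.inter_subset_left Set.inter_subset_left
      · exact fun i _ => (hA i).inter hF
    have hmu : Tendsto (fun j => μ (T j ∩ F)) atTop (𝓝 0) := by
      have h := tendsto_measure_iInter_atTop (μ := μ) (s := fun j => T j ∩ F)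
        (fun j => ((hTm j).inter hF).nullMeasurableSet)
        (by
          intro a b hab x hx
          simp only [hT, Set.mem_iUnion, Set.mem_inter_iff, Set.mem_sdiff, Finset.mem_range] at hx ⊢
          grind)
        ⟨0, ((measure_mono Set.inter_subset_right).trans_lt hFf).ne⟩
      have he : ⋂ j, T j ∩ F = ∅ := by
        ext x
        simp only [hT, Set.mem_iInter, Set.mem_iUnion, Set.mem_inter_iff, Set.mem_sdiff, Finset.mem_range,
          Set.mem_empty_iff_false, iff_false]
        intro h
        obtain ⟨⟨⟨i, hi⟩, -⟩, -⟩ := h 0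
        exact (h (i+1)).1.2 ⟨i, by simp, hi⟩
      rw [he, measure_empty] at h
      exact h
    have hLT : Tendsto (fun j => L (T j ∩ F)) atTop (𝓝 0) := by
      rw [ENNReal.tendsto_nhds_zero]
      intro ε hε
      obtain ⟨B, hB⟩ := hUI (ε / 2) (ENNReal.half_pos hε.ne')
      have h2 : Tendsto (fun j => (B : ENNReal) * μ (T j ∩ F)) atTop (𝓝 0) := by
        simpa using ENNReal.Tendsto.const_mul hmu (Or.inr ENNReal.coe_ne_top)
      filter_upwards [(ENNReal.tendsto_nhds_zero.1 h2) (ε/2) (ENNReal.half_pos hε.ne')] with j hj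
      refine le_of_tendsto (hL _) (Eventually.of_forall fun n => ?_)
      calc _ ≤ _ := hB n _ ((hTm j).inter hF)
        _ ≤ ε / 2 + ε / 2 := by gcongr
        _ = ε := ENNReal.add_halves ε
    have h3 := (ENNReal.tendsto_nat_tsum (fun i => L (A i ∩ F))).add hLT
    rw [add_zero] at h3
    refine tendsto_nhds_unique ?_ h3
    exact tendsto_const_nhds.congr h1
  · intro A hA
    rw [Measure.ofMeasurable_apply _ hA]

theorem exists_limit_measure {X : Type*} [MeasurableSpace X] (μ : Measure X) [SigmaFinite μ]
    (l : ℕ → Measure X) (U : Ultrafilter ℕ) (C : ENNReal) (hC : ∀ n, l n Set.univ ≤ C)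
    (hUI : ∀ ε : ENNReal, 0 < ε → ∃ B : NNReal, ∀ n A, MeasurableSet A → l n A ≤ B * μ A + ε)
    (hac : ∀ n, l n ≪ μ) :
    ∃ m : Measure X, m Set.univ ≤ C ∧ m ≪ μ ∧ ∀ A, MeasurableSet A → μ A < ⊤ →
      Tendsto (fun n => l n A) U (𝓝 (m A)) := by
  choose L hL using fun A => exists_ultra_lim U (fun n => l n A)
  choose ν hν using exists_limit_measure_on μ l U hUI L hL
  let E := disjointed (spanningSets μ)
  have hEm : ∀ k, MeasurableSet (E k) := fun k =>
    MeasurableSet.disjointed (measurableSet_spanningSets μ) k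
  have hEf : ∀ k, μ (E k) < ⊤ := fun k =>
    (measure_mono (disjointed_subset _ _)).trans_lt (measure_spanningSets_lt_top μ k)
  let m := Measure.sum fun k => ν (E k) (hEm k) (hEf k)
  have key : ∀ A, MeasurableSet A → μ A < ⊤ → m A = L A := by
    intro A hA hf
    have h1 : ν A hA hf A = L A := by rw [hν _ _ _ _ hA, Set.inter_self]
    rw [← h1, Measure.sum_apply _ hA]
    have h2 : A = ⋃ k, A ∩ E k := by
      rw [← Set.inter_iUnion, iUnion_disjointed, iUnion_spanningSets, Set.inter_univ]
    have h3 : ν A hA hf A = ν A hA hf (⋃ k, A ∩ E k) := congrArg (fun s => ν A hA hf s) h2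
    rw [h3, measure_iUnion]
    · refine tsum_congr fun k => ?_
      rw [hν _ _ _ _ hA, hν _ _ _ _ (hA.inter (hEm k))]
      congr 1
      ext x
      simp only [Set.mem_inter_iff]
      tauto
    · intro a b hab
      exact (disjoint_disjointed _ hab).mono Set.inter_subset_right Set.inter_subset_right
    · exact fun k => hA.inter (hEm k)
  have hlim : ∀ A, MeasurableSet A → μ A < ⊤ →
      Tendsto (fun n => l n A) U (𝓝 (m A)) := fun A hA hf => by
    rw [key A hA hf]; exact hL A
  refine ⟨m, ?_, ?_, hlim⟩
  · have h := tendsto_measure_iUnion_atTop (μ := m) (monotone_spanningSets μ)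
    rw [iUnion_spanningSets] at h
    refine le_of_tendsto h (Eventually.of_forall fun k => ?_)
    refine le_of_tendsto (hlim _ (measurableSet_spanningSets μ k)
      (measure_spanningSets_lt_top μ k)) (Eventually.of_forall fun n => ?_)
    exact (measure_mono (Set.subset_univ _)).trans (hC n)
  · refine Measure.AbsolutelyContinuous.mk fun A hA h0 => ?_
    have h := hlim A hA (by simp [h0])
    simp only [fun n => hac n h0] at h
    exact tendsto_nhds_unique h tendsto_const_nhds

theorem exists_limit_fun {X : Type*} [MeasurableSpace X] (μ : Measure X) [SigmaFinite μ]
    (W : ℕ → X → ℝ) (U : Ultrafilter ℕ)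
    (hint : ∀ n, Integrable (W n) μ)
    (hbdd : ∃ C : ℝ, ∀ n, ∫ p, |W n p| ∂μ ≤ C)
    (htail : ∀ ε > (0:ℝ), ∃ B : ℝ, ∀ n,
      ∫ p in {p | B < |W n p|}, |W n p| ∂μ < ε) :
    ∃ g : X → ℝ, Integrable g μ ∧ ∀ A, MeasurableSet A → μ A < ⊤ →
      Tendsto (fun n => ∫ x in A, max (W n x) 0 ∂μ) U (𝓝 (∫ x in A, g x ∂μ)) := by
  obtain ⟨C, hC⟩ := hbdd
  have hla : ∀ n A, ∫⁻ x in A, ENNReal.ofReal (W n x) ∂μ ≤ ∫⁻ x in A, ENNReal.ofReal |W n x| ∂μ :=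
    fun n A => lintegral_mono fun x => ENNReal.ofReal_le_ofReal (le_abs_self _)
  have hofi : ∀ n (A : Set X), ∫⁻ x in A, ENNReal.ofReal |W n x| ∂μ
      = ENNReal.ofReal (∫ x in A, |W n x| ∂μ) := fun n A =>
    (ofReal_integral_eq_lintegral_ofReal (hint n).abs.integrableOn
      (Eventually.of_forall fun x => abs_nonneg _)).symm
  obtain ⟨m, hmC, hmac, hm⟩ := exists_limit_measure μ
    (fun n => μ.withDensity fun x => ENNReal.ofReal (W n x)) U (ENNReal.ofReal C)
    (by
      intro n
      rw [withDensity_apply _ MeasurableSet.univ]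
      refine (hla n _).trans ?_
      rw [hofi]
      refine ENNReal.ofReal_le_ofReal ?_
      simpa using hC n)
    (by
      intro ε hε
      obtain ⟨δ, hδ0, hδ⟩ : ∃ δ : ℝ, 0 < δ ∧ ENNReal.ofReal δ ≤ ε := by
        obtain ⟨r, hr0, hr⟩ := ENNReal.lt_iff_exists_nnreal_btwn.1 hε
        exact ⟨r, by exact_mod_cast hr0, by simpa using hr.le⟩
      obtain ⟨B, hB⟩ := htail δ hδ0
      refine ⟨B.toNNReal, fun n A hA => ?_⟩
      rw [withDensity_apply _ hA]
      refine (hla n _).trans ?_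
      have hnm : NullMeasurableSet {p | B < |W n p|} μ :=
        nullMeasurableSet_lt aemeasurable_const (hint n).abs.aemeasurable
      calc ∫⁻ x in A, ENNReal.ofReal |W n x| ∂μ
          ≤ ∫⁻ x in A, ((B.toNNReal : ENNReal)
              + {p | B < |W n p|}.indicator (fun x => ENNReal.ofReal |W n x|) x) ∂μ := by
            refine lintegral_mono fun x => ?_
            by_cases hx : B < |W n x|
            · simp [Set.indicator, hx]
            · simp only [Set.indicator, Set.mem_ofPred_eq, hx, if_false, add_zero]
              exact ENNReal.ofReal_le_ofReal (not_lt.1 hx)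
        _ = B.toNNReal * μ A + ∫⁻ x in A,
              {p | B < |W n p|}.indicator (fun x => ENNReal.ofReal |W n x|) x ∂μ := by
            rw [lintegral_add_left measurable_const]; simp
        _ ≤ B.toNNReal * μ A + ∫⁻ x,
              {p | B < |W n p|}.indicator (fun x => ENNReal.ofReal |W n x|) x ∂μ := by
            gcongr; exact Measure.restrict_le_self
        _ ≤ B.toNNReal * μ A + ε := by
            gcongr
            rw [lintegral_indicator₀ hnm, hofi]
            exact (ENNReal.ofReal_le_ofReal (hB n).le).trans hδ)
    (fun n => withDensity_absolutelyContinuous _ _)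
  have hmfin : IsFiniteMeasure m := ⟨hmC.trans_lt ENNReal.ofReal_lt_top⟩
  refine ⟨fun x => (m.rnDeriv μ x).toReal, Measure.integrable_toReal_rnDeriv, fun A hA hf => ?_⟩
  rw [Measure.setIntegral_toReal_rnDeriv hmac]
  have h := (ENNReal.tendsto_toReal (measure_ne_top m A)).comp (hm A hA hf)
  refine h.congr fun n => ?_
  simp only [Function.comp]
  rw [withDensity_apply _ hA, integral_eq_lintegral_of_nonneg_ae]
  · simp
  · exact Eventually.of_forall fun x => le_max_right _ _
  · exact ((hint n).pos_part).aestronglyMeasurable.restrict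

theorem exists_limit_fun' {X : Type*} [MeasurableSpace X] (μ : Measure X) [SigmaFinite μ]
    (W : ℕ → X → ℝ) (U : Ultrafilter ℕ)
    (hint : ∀ n, Integrable (W n) μ)
    (hbdd : ∃ C : ℝ, ∀ n, ∫ p, |W n p| ∂μ ≤ C)
    (htail : ∀ ε > (0:ℝ), ∃ B : ℝ, ∀ n,
      ∫ p in {p | B < |W n p|}, |W n p| ∂μ < ε) :
    ∃ g : X → ℝ, Integrable g μ ∧ ∀ A, MeasurableSet A → μ A < ⊤ →
      Tendsto (fun n => ∫ x in A, W n x ∂μ) U (𝓝 (∫ x in A, g x ∂μ)) := by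
  obtain ⟨g, hg, hgt⟩ := exists_limit_fun μ W U hint hbdd htail
  obtain ⟨g', hg', hgt'⟩ := exists_limit_fun μ (fun n x => - W n x) U (fun n => (hint n).neg)
    (by simpa using hbdd) (by simpa using htail)
  refine ⟨fun x => g x - g' x, hg.sub hg', fun A hA hf => ?_⟩
  rw [integral_sub hg.integrableOn hg'.integrableOn]
  refine ((hgt A hA hf).sub (hgt' A hA hf)).congr fun n => ?_
  have hn : Integrable (fun x => max (-W n x) 0) μ := (hint n).neg.pos_part
  rw [← integral_sub (hint n).pos_part.integrableOn hn.integrableOn]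
  refine integral_congr_ae (Eventually.of_forall fun x => ?_)
  beta_reduce
  rcases le_total (W n x) 0 with h | h
  · rw [max_eq_right h, max_eq_left (by linarith)]; ring
  · rw [max_eq_left h, max_eq_right (by linarith)]; ring

theorem le_cutNorm {S : Type*} [MeasurableSpace S] (μ : Measure S)
    (F : S × S → ℝ) (hF : Integrable F (μ.prod μ)) (T U : Set S)
    (hT : MeasurableSet T) (hU : MeasurableSet U) :
    |∫ p in T ×ˢ U, F p ∂(μ.prod μ)| ≤ cutNorm μ F := by
  refine le_ciSup (f := fun TU : {TU : Set S × Set S // MeasurableSet TU.1 ∧ MeasurableSet TU.2} =>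
    |∫ p in TU.1.1 ×ˢ TU.1.2, F p ∂(μ.prod μ)|) ?_ ⟨(T, U), hT, hU⟩
  refine ⟨∫ p, |F p| ∂(μ.prod μ), ?_⟩
  rintro _ ⟨TU, rfl⟩
  refine (abs_integral_le_integral_abs).trans ?_
  exact setIntegral_le_integral hF.abs (Eventually.of_forall fun x => abs_nonneg _)

theorem cutNorm_complete_of_uniformlyIntegrable {S : Type*} [MeasurableSpace S]
    (μ : Measure S) [SigmaFinite μ]
    (W : ℕ → S × S → ℝ)
    (hsymm : ∀ n x y, W n (x, y) = W n (y, x))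
    (hint : ∀ n, Integrable (W n) (μ.prod μ))
    (hbdd : ∃ C : ℝ, ∀ n, ∫ p, |W n p| ∂(μ.prod μ) ≤ C)
    (htail : ∀ ε > (0:ℝ), ∃ B : ℝ, ∀ n,
      ∫ p in {p | B < |W n p|}, |W n p| ∂(μ.prod μ) < ε)
    (hcauchy : ∀ ε > (0:ℝ), ∃ N, ∀ m ≥ N, ∀ n ≥ N,
      cutNorm μ (fun p => W m p - W n p) < ε) :
    ∃ V : S × S → ℝ, (∀ x y, V (x, y) = V (y, x)) ∧ Integrable V (μ.prod μ) ∧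
      Tendsto (fun n => cutNorm μ (fun p => W n p - V p)) atTop (𝓝 0) := by
  obtain ⟨V, hV, hVt⟩ := exists_limit_fun' (μ.prod μ) W (hyperfilter ℕ) hint hbdd htail
  have hVs : Integrable (fun p : S × S => V p.swap) (μ.prod μ) := hV.swap
  have key : ∀ ε > (0:ℝ), ∃ N, ∀ n ≥ N, ∀ T U : Set S, MeasurableSet T → MeasurableSet U →
      |∫ p in T ×ˢ U, (W n p - V p) ∂(μ.prod μ)| ≤ ε := by
    intro ε hε
    obtain ⟨N, hN⟩ := hcauchy ε hε
    refine ⟨N, fun n hn T U hT hU => ?_⟩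
    let A : ℕ → Set (S × S) := fun k => (T ∩ spanningSets μ k) ×ˢ (U ∩ spanningSets μ k)
    have hT' := fun k => hT.inter (measurableSet_spanningSets μ k)
    have hU' := fun k => hU.inter (measurableSet_spanningSets μ k)
    have hAm : ∀ k, MeasurableSet (A k) := fun k => (hT' k).prod (hU' k)
    have hAf : ∀ k, μ.prod μ (A k) < ⊤ := fun k => by
      rw [Measure.prod_prod]
      exact ENNReal.mul_lt_top
        ((measure_mono Set.inter_subset_right).trans_lt (measure_spanningSets_lt_top μ k))
        ((measure_mono Set.inter_subset_right).trans_lt (measure_spanningSets_lt_top μ k))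
    have hAmono : Monotone A := fun a b hab =>
      Set.prod_mono (Set.inter_subset_inter_right _ (monotone_spanningSets μ hab))
        (Set.inter_subset_inter_right _ (monotone_spanningSets μ hab))
    have hAU : ⋃ k, A k = T ×ˢ U := by
      rw [Set.iUnion_prod_of_monotone, ← Set.inter_iUnion, ← Set.inter_iUnion,
        iUnion_spanningSets, Set.inter_univ, Set.inter_univ]
      · exact fun a b hab => Set.inter_subset_inter_right _ (monotone_spanningSets μ hab)
      · exact fun a b hab => Set.inter_subset_inter_right _ (monotone_spanningSets μ hab)
    have hlim := tendsto_setIntegral_of_monotone (μ := μ.prod μ) (f := fun p => W n p - V p)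
      hAm hAmono ((hint n).sub hV).integrableOn
    rw [hAU] at hlim
    refine le_of_tendsto hlim.abs (Eventually.of_forall fun k => ?_)
    rw [integral_sub (hint n).integrableOn hV.integrableOn]
    refine le_of_tendsto ((tendsto_const_nhds.sub (hVt _ (hAm k) (hAf k))).abs) ?_
    refine Eventually.filter_mono Nat.hyperfilter_le_atTop ?_
    filter_upwards [eventually_ge_atTop N] with m hm
    rw [← integral_sub (hint n).integrableOn (hint m).integrableOn]
    exact (le_cutNorm μ (fun p => W n p - W m p) ((hint n).sub (hint m)) _ _ (hT' k) (hU' k)).trans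
      (hN n hn m hm).le
  refine ⟨fun p => (V p + V p.swap) / 2, fun x y => by simp [add_comm], (hV.add hVs).div_const 2, ?_⟩
  rw [Metric.tendsto_atTop]
  intro ε hε
  obtain ⟨N, hN⟩ := key (ε / 2) (by positivity)
  refine ⟨N, fun n hn => ?_⟩
  have h0 : 0 ≤ cutNorm μ (fun p => W n p - (V p + V p.swap) / 2) :=
    Real.iSup_nonneg fun _ => abs_nonneg _
  rw [Real.dist_eq, sub_zero, abs_of_nonneg h0]
  refine lt_of_le_of_lt ?_ (half_lt_self hε)
  refine Real.iSup_le ?_ (by positivity)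
  rintro ⟨⟨T, U⟩, hT, hU⟩
  simp only at hT hU ⊢
  have hd : Integrable (fun p => W n p - V p) (μ.prod μ) := (hint n).sub hV
  have hds : Integrable (fun p : S × S => W n p.swap - V p.swap) (μ.prod μ) := hd.swap
  have e : ∫ p in T ×ˢ U, (W n p - (V p + V p.swap) / 2) ∂(μ.prod μ)
      = (∫ p in T ×ˢ U, (W n p - V p) ∂(μ.prod μ)
        + ∫ p in U ×ˢ T, (W n p - V p) ∂(μ.prod μ)) / 2 := by
    rw [← setIntegral_prod_swap U T (fun p => W n p - V p),
      ← integral_add hd.integrableOn hds.integrableOn, ← integral_div]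
    refine integral_congr_ae (Eventually.of_forall fun p => ?_)
    have := hsymm n p.1 p.2
    simp only [Prod.swap] at *
    rw [← this]
    simp only [Prod.mk.eta]
    ring
  rw [e]
  have a1 := abs_le.1 (hN n hn T U hT hU)
  have a2 := abs_le.1 (hN n hn U T hU hT)
  rw [abs_le]
  constructor <;> linarith
end

section
/- Let (S, μ) be a σ-finite measure space, 1 < p ≤ ∞, C, C₁ < ∞. Then the set of symmetric functions W on S × S with ‖W‖_{L^p} ≤ C and ‖W‖_{L¹} ≤ C₁ is complete for the cut norm: every Cauchy sequence (for the cut norm) of such functions converges in cut norm to a symmetric function W satisfying ‖W‖_{L^p} ≤ C and ‖W‖_{L¹} ≤ C₁. -/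
open MeasureTheory Filter Topology

lemma ui_aux {X : Type*} [MeasurableSpace X] (ρ : Measure X)
    (p : ENNReal) (hp : 1 < p) (C : NNReal) (W : ℕ → X → ℝ)
    (hint : ∀ n, Integrable (W n) ρ) (hLp : ∀ n, eLpNorm (W n) p ρ ≤ C)
    (ε : ℝ) (hε : 0 < ε) :
    ∃ δ : ENNReal, 0 < δ ∧ ∀ n, ∀ A : Set X, ρ A ≤ δ → |∫ x in A, W n x ∂ρ| ≤ ε := by
  set θ : ℝ := 1 / (1 : ENNReal).toReal - 1 / p.toReal with hθ
  have hθ0 : 0 < θ := by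
    rw [hθ]
    by_cases hpt : p = ⊤
    · simp [hpt]
    · have : 1 < p.toReal := by
        rw [← ENNReal.toReal_one]
        exact (ENNReal.toReal_lt_toReal (by simp) hpt).2 hp
      have := (div_lt_one (by linarith)).2 this
      simp only [ENNReal.toReal_one]; linarith
  have ht : Tendsto (fun x : ENNReal => (C : ENNReal) * x ^ θ) (𝓝 0) (𝓝 0) := by
    have h1 : Tendsto (fun x : ENNReal => x ^ θ) (𝓝 0) (𝓝 0) := by
      have := (ENNReal.continuous_rpow_const (y := θ)).tendsto 0
      rwa [ENNReal.zero_rpow_of_pos hθ0] at this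
    have := ENNReal.Tendsto.const_mul (a := (C : ENNReal)) h1 (Or.inr (by simp))
    simpa using this
  have hev := ht.eventually (Iio_mem_nhds (ENNReal.ofReal_pos.2 hε))
  obtain ⟨δ, hδ, hs⟩ := ENNReal.nhds_zero_basis_Iic.mem_iff.1 hev
  refine ⟨δ, hδ, fun n A hA => ?_⟩
  have h1 : eLpNorm (W n) 1 (ρ.restrict A) ≤ C * (ρ A) ^ θ := by
    have := eLpNorm_le_eLpNorm_mul_rpow_measure_univ (μ := ρ.restrict A) hp.le
      (hint n).aestronglyMeasurable.restrict
    rw [Measure.restrict_apply_univ] at this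
    refine this.trans ?_
    gcongr
    exact (eLpNorm_restrict_le _ _ _ _).trans (hLp n)
  have h2 : eLpNorm (W n) 1 (ρ.restrict A) < ENNReal.ofReal ε := h1.trans_lt (hs hA)
  have h3 : ‖∫ x in A, W n x ∂ρ‖ₑ ≤ ENNReal.ofReal ε := by
    refine (enorm_integral_le_lintegral_enorm _).trans ?_
    rw [← eLpNorm_one_eq_lintegral_enorm]
    exact h2.le
  rw [← Real.norm_eq_abs]
  rw [← ofReal_norm] at h3
  exact (ENNReal.ofReal_le_ofReal_iff hε.le).1 h3

lemma tail_aux {X : Type*} [MeasurableSpace X] (ρ : Measure X) [IsFiniteMeasure ρ]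
    (W : ℕ → X → ℝ) (hint : ∀ n, Integrable (W n) ρ)
    (hui : ∀ ε : ℝ, 0 < ε →
      ∃ δ : ENNReal, 0 < δ ∧ ∀ n, ∀ A : Set X, ρ A ≤ δ → |∫ x in A, W n x ∂ρ| ≤ ε)
    (f : ℕ → Set X) (hd : Pairwise (Function.onFun Disjoint f)) (hm : ∀ i, MeasurableSet (f i))
    (ε : ℝ) (hε : 0 < ε) :
    ∃ s0 : Finset ℕ, ∀ s ⊇ s0, ∀ n,
      |(∫ x in ⋃ i, f i, W n x ∂ρ) - ∑ i ∈ s, ∫ x in f i, W n x ∂ρ| ≤ ε := by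
  obtain ⟨δ, hδ, hb⟩ := hui ε hε
  have hsum : ∑' i, ρ (f i) ≠ ⊤ := by
    rw [← measure_iUnion hd hm]; exact measure_ne_top _ _
  have ht := ENNReal.tendsto_tsum_compl_atTop_zero hsum
  have hev := ht.eventually (Iic_mem_nhds hδ)
  obtain ⟨s0, hs0⟩ := eventually_atTop.1 hev
  refine ⟨s0, fun s hs n => ?_⟩
  have h1 := hs0 s hs
  have hsub : (⋃ i ∈ s, f i) ⊆ ⋃ i, f i := Set.iUnion₂_subset fun i _ => Set.subset_iUnion f i
  have hms : MeasurableSet (⋃ i ∈ s, f i) := Finset.measurableSet_biUnion _ fun i _ => hm i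
  have e1 : (∫ x in ⋃ i ∈ s, f i, W n x ∂ρ) = ∑ i ∈ s, ∫ x in f i, W n x ∂ρ :=
    integral_biUnion_finset s (fun i _ => hm i) (fun i _ j _ hij => hd hij)
      (fun i _ => (hint n).integrableOn)
  rw [← e1, ← setIntegral_sdiff hms (hint n).integrableOn hsub]
  refine hb n _ (le_trans ?_ h1)
  refine le_trans (measure_mono ?_) (measure_iUnion_le _)
  rintro x ⟨hx1, hx2⟩
  obtain ⟨i, hi⟩ := Set.mem_iUnion.1 hx1
  refine Set.mem_iUnion.2 ⟨⟨i, fun his => hx2 ?_⟩, hi⟩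
  exact Set.mem_iUnion₂.2 ⟨i, his, hi⟩

lemma weak_limit_aux {X : Type*} [mX : MeasurableSpace X] (ρ : Measure X) [IsFiniteMeasure ρ]
    (W : ℕ → X → ℝ) (hint : ∀ n, Integrable (W n) ρ)
    (hui : ∀ ε : ℝ, 0 < ε →
      ∃ δ : ENNReal, 0 < δ ∧ ∀ n, ∀ A : Set X, ρ A ≤ δ → |∫ x in A, W n x ∂ρ| ≤ ε)
    (P : Set (Set X)) (hgen : mX = MeasurableSpace.generateFrom P) (hpi : IsPiSystem P)
    (huniv : Set.univ ∈ P)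
    (hP : ∀ A ∈ P, CauchySeq (fun n => ∫ x in A, W n x ∂ρ)) :
    ∃ V : X → ℝ, Measurable V ∧ Integrable V ρ ∧ ∀ A, MeasurableSet A →
      Tendsto (fun n => ∫ x in A, W n x ∂ρ) atTop (𝓝 (∫ x in A, V x ∂ρ)) := by
  classical
  have hC : ∀ A, MeasurableSet A → CauchySeq (fun n => ∫ x in A, W n x ∂ρ) := by
    refine MeasurableSpace.induction_on_inter hgen hpi ?_ hP ?_ ?_
    · simpa using cauchySeq_const (0 : ℝ)
    · intro t ht h
      have h2 := (hP _ huniv).add h.neg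
      convert h2 using 1
      funext n
      have := integral_add_compl ht (hint n)
      simp only [Pi.add_apply, Pi.neg_apply, Measure.restrict_univ]
      linarith
    · intro f hd hm hf
      rw [Metric.cauchySeq_iff']
      intro ε hε
      obtain ⟨s, hs⟩ := tail_aux ρ W hint hui f hd hm (ε / 4) (by linarith)
      have hs := hs s subset_rfl
      have hsum : CauchySeq (fun n => ∑ i ∈ s, ∫ x in f i, W n x ∂ρ) := by
        have : ∀ i, ∃ l, Tendsto (fun n => ∫ x in f i, W n x ∂ρ) atTop (𝓝 l) :=
          fun i => cauchySeq_tendsto_of_complete (hf i)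
        choose l hl using this
        exact (tendsto_finsetSum s fun i _ => hl i).cauchySeq
      obtain ⟨N, hN⟩ := Metric.cauchySeq_iff'.1 hsum (ε / 4) (by linarith)
      refine ⟨N, fun n hn => ?_⟩
      have a1 := hN n hn
      have a2 := abs_le.1 (hs n)
      have a3 := abs_le.1 (hs N)
      rw [Real.dist_eq, abs_lt] at *
      constructor <;> linarith
  have hL : ∀ A, ∃ l, MeasurableSet A → Tendsto (fun n => ∫ x in A, W n x ∂ρ) atTop (𝓝 l) := by
    intro A
    by_cases hA : MeasurableSet A
    · obtain ⟨l, hl⟩ := cauchySeq_tendsto_of_complete (hC A hA)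
      exact ⟨l, fun _ => hl⟩
    · exact ⟨0, fun h => absurd h hA⟩
  choose L hL using hL
  let ν : SignedMeasure X :=
    { measureOf' := fun A => if MeasurableSet A then L A else 0
      empty' := by
        rw [if_pos MeasurableSet.empty]
        have := hL ∅ MeasurableSet.empty
        simp only [Measure.restrict_empty, integral_zero_measure] at this
        exact tendsto_nhds_unique this tendsto_const_nhds
      not_measurable' := fun A hA => if_neg hA
      m_iUnion' := by
        intro f hm hd
        simp only [hm, MeasurableSet.iUnion hm, if_true]
        rw [HasSum, SummationFilter.unconditional_filter, Metric.tendsto_atTop]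
        intro ε hε
        obtain ⟨s, hs⟩ := tail_aux ρ W hint hui f hd hm (ε / 2) (by linarith)
        refine ⟨s, fun t ht => ?_⟩
        have h1 : Tendsto (fun n => |(∫ x in ⋃ i, f i, W n x ∂ρ) - ∑ i ∈ t, ∫ x in f i, W n x ∂ρ|)
            atTop (𝓝 |L (⋃ i, f i) - ∑ i ∈ t, L (f i)|) :=
          ((hL _ (MeasurableSet.iUnion hm)).sub
            (tendsto_finsetSum t fun i _ => hL _ (hm i))).abs
        have h2 := le_of_tendsto h1 (Eventually.of_forall fun n => hs t ht n)
        rw [dist_comm, Real.dist_eq]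
        linarith }
  have hν : ∀ A, MeasurableSet A → ν A = L A := fun A hA => if_pos hA
  have hac : VectorMeasure.AbsolutelyContinuous ν ρ.toENNRealVectorMeasure := by
    refine VectorMeasure.AbsolutelyContinuous.mk fun A hA h0 => ?_
    rw [Measure.toENNRealVectorMeasure_apply_measurable hA] at h0
    rw [hν A hA]
    have := hL A hA
    simp only [Measure.restrict_eq_zero.2 h0, integral_zero_measure] at this
    exact tendsto_nhds_unique this tendsto_const_nhds
  have hrn := SignedMeasure.withDensityᵥ_rnDeriv_eq ν ρ hac
  refine ⟨ν.rnDeriv ρ, SignedMeasure.measurable_rnDeriv _ _, SignedMeasure.integrable_rnDeriv _ _,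
    fun A hA => ?_⟩
  rw [← withDensityᵥ_apply (SignedMeasure.integrable_rnDeriv _ _) hA, hrn, hν A hA]
  exact hL A hA

lemma tangent_aux (p : ℝ) (hp : 1 ≤ p) (v w : ℝ) :
    |v| ^ p + (p * (Real.sign v * |v| ^ (p - 1))) * (w - v) ≤ |w| ^ p := by
  rcases eq_or_ne v 0 with rfl | hv
  · simp [Real.zero_rpow (by linarith : p ≠ 0)]
    positivity
  have ha : 0 < |v| := abs_pos.2 hv
  have hb := one_add_mul_self_le_rpow_one_add (s := |w| / |v| - 1)
    (by have : 0 ≤ |w| / |v| := by positivity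
        linarith) hp
  have e : (1 + (|w| / |v| - 1)) = |w| / |v| := by ring
  rw [e, Real.div_rpow (abs_nonneg _) ha.le, le_div_iff₀ (by positivity)] at hb
  have e2 : |v| ^ p = |v| ^ (p - 1) * |v| := by
    rw [← Real.rpow_add_one ha.ne']; ring_nf
  have e3 : Real.sign v * v = |v| := by
    rcases lt_or_gt_of_ne hv with h | h
    · rw [Real.sign_of_neg h, abs_of_neg h]; ring
    · rw [Real.sign_of_pos h, abs_of_pos h]; ring
  have e4 : Real.sign v * w ≤ |w| := by
    rcases lt_or_gt_of_ne hv with h | h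
    · rw [Real.sign_of_neg h]; linarith [neg_le_abs w]
    · rw [Real.sign_of_pos h]; linarith [le_abs_self w]
  have e5 : 0 ≤ p * |v| ^ (p - 1) := by positivity
  refine le_trans ?_ hb
  have e6 : (1 + p * (|w| / |v| - 1)) * |v| ^ p
      = |v| ^ p + (p * |v| ^ (p - 1)) * (|w| - |v|) := by
    rw [e2]; field_simp
  rw [e6]
  have := mul_le_mul_of_nonneg_left e4 e5
  have e7 : (p * (Real.sign v * |v| ^ (p - 1))) * (w - v)
     = (p * |v| ^ (p - 1)) * (Real.sign v * w) - (p * |v| ^ (p - 1)) * (Real.sign v * v) := by ring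
  rw [e7, e3]
  linarith

lemma bdd_test_aux {X : Type*} [MeasurableSpace X] (ρ : Measure X)
    (W : ℕ → X → ℝ) (hint : ∀ n, Integrable (W n) ρ) (C₁ : ℝ)
    (hL1 : ∀ n, ∫ x, |W n x| ∂ρ ≤ C₁)
    (V : X → ℝ) (hV : Integrable V ρ)
    (hconv : ∀ A, MeasurableSet A →
      Tendsto (fun n => ∫ x in A, W n x ∂ρ) atTop (𝓝 (∫ x in A, V x ∂ρ)))
    (f : X → ℝ) (hf : Measurable f) (M : ℝ) (hM : ∀ x, |f x| ≤ M) :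
    Tendsto (fun n => ∫ x, f x * W n x ∂ρ) atTop (𝓝 (∫ x, f x * V x ∂ρ)) := by
  have hC₁ : 0 ≤ C₁ := le_trans (integral_nonneg fun x => abs_nonneg _) (hL1 0)
  set D : ℝ := C₁ + ∫ x, |V x| ∂ρ + 1 with hD
  have hVn : 0 ≤ ∫ x, |V x| ∂ρ := integral_nonneg fun x => abs_nonneg _
  have hD0 : 0 < D := by linarith
  rw [Metric.tendsto_atTop]
  intro ε hε
  -- the mesh
  set η : ℝ := ε / (4 * D) with hη
  have hη0 : 0 < η := by positivity
  set k : X → ℤ := fun x => ⌊f x / η⌋ with hk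
  have hkm : Measurable k := Int.measurable_floor.comp (hf.div_const η)
  set s : Finset ℤ := Finset.Icc (-⌈M / η⌉ - 1) ⌈M / η⌉ with hs
  have hks : ∀ x, k x ∈ s := by
    intro x
    have h := abs_le.1 (hM x)
    rw [hs, Finset.mem_Icc]
    constructor
    · rw [hk]
      refine Int.le_floor.2 ?_
      have h2 : -(M / η) ≤ f x / η := by rw [← neg_div]; gcongr; exact h.1
      have h3 := Int.le_ceil (M / η)
      push_cast
      linarith
    · have h2 : f x / η ≤ M / η := by gcongr; exact h.2
      exact (Int.floor_le_ceil _).trans (Int.ceil_mono h2)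
  have hclose : ∀ x, |f x - k x * η| ≤ η := by
    intro x
    have h1 := Int.floor_le (f x / η)
    have h2 := Int.lt_floor_add_one (f x / η)
    rw [le_div_iff₀ hη0] at h1
    rw [div_lt_iff₀ hη0] at h2
    rw [abs_le]
    constructor <;> simp only [hk] <;> linarith
  have hkeq : ∀ (U : X → ℝ), Integrable U ρ →
      ∫ x, (k x * η) * U x ∂ρ = ∑ j ∈ s, (j * η) * ∫ x in k ⁻¹' {j}, U x ∂ρ := by
    intro U hU
    have hmj : ∀ j, MeasurableSet (k ⁻¹' {j}) := fun j => hkm (measurableSet_singleton j)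
    have : ∀ x, (k x * η) * U x = ∑ j ∈ s, (j * η) * (k ⁻¹' {j}).indicator U x := by
      intro x
      rw [Finset.sum_eq_single (k x)]
      · simp
      · intro b _ hb
        rw [Set.indicator_of_notMem (by simpa using hb.symm)]; simp
      · intro h; exact absurd (hks x) h
    simp_rw [this]
    rw [integral_finsetSum _ fun j _ => (hU.indicator (hmj j)).const_mul _]
    refine Finset.sum_congr rfl fun j _ => ?_
    rw [integral_const_mul, integral_indicator (hmj j)]
  have hbd : ∀ (U : X → ℝ), Integrable U ρ →
      |(∫ x, f x * U x ∂ρ) - ∫ x, (k x * η) * U x ∂ρ| ≤ η * ∫ x, |U x| ∂ρ := by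
    intro U hU
    have i1 : Integrable (fun x => f x * U x) ρ :=
      hU.bdd_mul hf.aestronglyMeasurable (Eventually.of_forall hM)
    have i2 : Integrable (fun x => (k x * η) * U x) ρ := by
      refine hU.bdd_mul (c := M + η) ?_ (Eventually.of_forall fun x => ?_)
      · exact ((measurable_from_top (f := fun j : ℤ => (j : ℝ)).comp hkm).mul_const η).aestronglyMeasurable
      · have a := abs_le.1 (hM x)
        have b := abs_le.1 (hclose x)
        rw [Real.norm_eq_abs, abs_le]
        constructor <;> linarith
    rw [← integral_sub i1 i2, ← integral_const_mul, ← Real.norm_eq_abs]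
    refine norm_integral_le_of_norm_le (hU.abs.const_mul η) (Eventually.of_forall fun x => ?_)
    rw [← sub_mul, norm_mul, Real.norm_eq_abs, Real.norm_eq_abs]
    exact mul_le_mul_of_nonneg_right (hclose x) (abs_nonneg _)
  have hlim : Tendsto (fun n => ∫ x, (k x * η) * W n x ∂ρ) atTop
      (𝓝 (∫ x, (k x * η) * V x ∂ρ)) := by
    simp_rw [hkeq _ (hint _)]
    rw [hkeq V hV]
    exact tendsto_finsetSum _ fun j _ =>
      (hconv _ (hkm (measurableSet_singleton j))).const_mul _
  obtain ⟨N, hN⟩ := Metric.tendsto_atTop.1 hlim (ε / 4) (by linarith)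
  refine ⟨N, fun n hn => ?_⟩
  have a1 := hN n hn
  have a2 := abs_le.1 (hbd _ (hint n))
  have a3 := abs_le.1 (hbd _ hV)
  have hηD : η * D = ε / 4 := by rw [hη]; field_simp
  have b1 : η * ∫ x, |W n x| ∂ρ ≤ ε / 4 := by
    rw [← hηD]; gcongr; linarith [hL1 n]
  have b2 : η * ∫ x, |V x| ∂ρ ≤ ε / 4 := by
    rw [← hηD]; gcongr; linarith
  rw [Real.dist_eq, abs_lt] at *
  constructor <;> linarith

lemma liminf_le_aux {X : Type*} [MeasurableSpace X] (ρ : Measure X) (p : ENNReal) (C : ENNReal)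
    (V : X → ℝ) (hV : Measurable V) (B : ℕ → Set X) (hB : ∀ n, MeasurableSet (B n))
    (hmono : ∀ x, ∃ N, ∀ n ≥ N, x ∈ B n)
    (h : ∀ n, eLpNorm V p (ρ.restrict (B n)) ≤ C) : eLpNorm V p ρ ≤ C := by
  have := Lp.eLpNorm_lim_le_liminf_eLpNorm (μ := ρ) (p := p) (f := fun n => (B n).indicator V)
    (fun n => (hV.indicator (hB n)).aestronglyMeasurable) V (Eventually.of_forall fun x => by
      obtain ⟨N, hN⟩ := hmono x
      refine tendsto_const_nhds.congr' ?_
      filter_upwards [eventually_ge_atTop N] with n hn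
      rw [Set.indicator_of_mem (hN n hn)])
  refine this.trans ?_
  simp_rw [eLpNorm_indicator_eq_eLpNorm_restrict (hB _)]
  refine (liminf_le_liminf (Eventually.of_forall h)).trans ?_
  simp

lemma norm_aux {X : Type*} [MeasurableSpace X] (ρ : Measure X) [IsFiniteMeasure ρ]
    (p : ENNReal) (hp : 1 ≤ p) (C : NNReal)
    (W : ℕ → X → ℝ) (hint : ∀ n, Integrable (W n) ρ) (C₁ : ℝ)
    (hL1 : ∀ n, ∫ x, |W n x| ∂ρ ≤ C₁) (hLp : ∀ n, eLpNorm (W n) p ρ ≤ C)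
    (V : X → ℝ) (hVm : Measurable V) (hV : Integrable V ρ)
    (hconv : ∀ A, MeasurableSet A →
      Tendsto (fun n => ∫ x in A, W n x ∂ρ) atTop (𝓝 (∫ x in A, V x ∂ρ))) :
    eLpNorm V p ρ ≤ C := by
  by_cases hpt : p = ⊤
  · subst hpt
    have hW : ∀ n, ∀ᵐ x ∂ρ, |W n x| ≤ C := by
      intro n
      have h := ae_le_eLpNormEssSup (f := W n) (μ := ρ)
      filter_upwards [h] with x hx
      have h2 : ‖W n x‖ₑ ≤ (C : ENNReal) := hx.trans (by simpa using hLp n)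
      rw [← Real.norm_eq_abs]
      exact_mod_cast (enorm_le_coe.1 h2)
    have hle : V ≤ᵐ[ρ] fun _ => (C : ℝ) := by
      refine ae_le_of_forall_setIntegral_le hV (integrable_const _) fun s hs _ => ?_
      refine le_of_tendsto (hconv s hs) (Eventually.of_forall fun n => ?_)
      refine integral_mono_ae (hint n).integrableOn (integrable_const _) ?_
      filter_upwards [ae_restrict_of_ae (hW n)] with x hx using (abs_le.1 hx).2
    have hge : (fun _ => -(C : ℝ)) ≤ᵐ[ρ] V := by
      refine ae_le_of_forall_setIntegral_le (integrable_const _) hV fun s hs _ => ?_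
      refine ge_of_tendsto (hconv s hs) (Eventually.of_forall fun n => ?_)
      refine integral_mono_ae (integrable_const _) (hint n).integrableOn ?_
      filter_upwards [ae_restrict_of_ae (hW n)] with x hx using (abs_le.1 hx).1
    rw [eLpNorm_exponent_top]
    refine eLpNormEssSup_le_of_ae_nnnorm_bound ?_
    filter_upwards [hle, hge] with x h1 h2
    rw [← NNReal.coe_le_coe, coe_nnnorm, Real.norm_eq_abs]
    exact abs_le.2 ⟨h2, h1⟩
  · have hp0 : p ≠ 0 := (zero_lt_one.trans_le hp).ne'
    set r : ℝ := p.toReal with hr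
    have hr1 : 1 ≤ r := by
      rw [hr, ← ENNReal.toReal_one]
      exact (ENNReal.toReal_le_toReal (by simp) hpt).2 hp
    have hr0 : 0 < r := by linarith
    have hWp : ∀ n, MemLp (W n) p ρ := fun n =>
      ⟨(hint n).aestronglyMeasurable, (hLp n).trans_lt (by simp)⟩
    have hWi : ∀ n, Integrable (fun x => |W n x| ^ r) ρ := fun n =>
      (hWp n).integrable_norm_rpow hp0 hpt
    have key : ∀ (U : X → ℝ), MemLp U p ρ →
        (eLpNorm U p ρ ≤ C ↔ ∫ x, |U x| ^ r ∂ρ ≤ (C : ℝ) ^ r) := by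
      intro U hU
      rw [hU.eLpNorm_eq_integral_rpow_norm hp0 hpt, ← ENNReal.ofReal_coe_nnreal,
        ENNReal.ofReal_le_ofReal_iff C.coe_nonneg, ← hr]
      exact Real.rpow_inv_le_iff_of_pos (integral_nonneg fun x => by positivity) C.coe_nonneg hr0
    refine liminf_le_aux ρ p C V hVm (fun M => {x | |V x| ≤ (M : ℝ)})
      (fun M => measurableSet_le (by fun_prop) measurable_const) (fun x => ?_) (fun M => ?_)
    · obtain ⟨N, hN⟩ := exists_nat_ge |V x|
      exact ⟨N, fun n hn => hN.trans (by exact_mod_cast hn)⟩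
    set B : Set X := {x | |V x| ≤ (M : ℝ)} with hB
    have hBm : MeasurableSet B := measurableSet_le (by fun_prop) measurable_const
    set U : X → ℝ := B.indicator V with hU
    have hUm : Measurable U := hVm.indicator hBm
    have hUM : ∀ x, |U x| ≤ M := by
      intro x
      by_cases hx : x ∈ B
      · rw [hU, Set.indicator_of_mem hx]; exact hx
      · rw [hU, Set.indicator_of_notMem hx]; simp
    have hUp : MemLp U p ρ :=
      MemLp.of_bound hUm.aestronglyMeasurable (M : ℝ) (Eventually.of_forall hUM)
    rw [← eLpNorm_indicator_eq_eLpNorm_restrict hBm]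
    rw [key U hUp]
    set g : X → ℝ := fun x => r * (Real.sign (U x) * |U x| ^ (r - 1)) with hg
    have hsm : Measurable Real.sign := by
      unfold Real.sign
      exact Measurable.ite measurableSet_Iio measurable_const
        (Measurable.ite measurableSet_Ioi measurable_const measurable_const)
    have hgm : Measurable g := by
      have h1 : Measurable fun x => Real.sign (U x) := hsm.comp hUm
      have h2 : Measurable fun x => |U x| ^ (r - 1) := by fun_prop
      exact (h1.mul h2).const_mul r
    have hgM : ∀ x, |g x| ≤ r * (M : ℝ) ^ (r - 1) := by
      intro x
      have h1 : |Real.sign (U x)| ≤ 1 := by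
        rcases Real.sign_apply_eq (U x) with h | h | h <;> simp [h]
      have h2 : |U x| ^ (r - 1) ≤ (M : ℝ) ^ (r - 1) :=
        Real.rpow_le_rpow (abs_nonneg _) (hUM x) (by linarith)
      rw [hg]
      simp only [abs_mul, abs_of_pos hr0]
      rw [abs_of_nonneg (by positivity : 0 ≤ |U x| ^ (r - 1))]
      gcongr
      calc _ ≤ 1 * |U x| ^ (r - 1) := by gcongr
        _ ≤ _ := by rw [one_mul]; exact h2
    have hlim := bdd_test_aux ρ W hint C₁ hL1 V hV hconv g hgm _ hgM
    have hgU : ∀ x, g x * V x = g x * U x := by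
      intro x
      by_cases hx : x ∈ B
      · rw [hU, Set.indicator_of_mem hx]
      · have : U x = 0 := by rw [hU, Set.indicator_of_notMem hx]
        simp [hg, this]
    simp_rw [hgU] at hlim
    have iU : Integrable (fun x => |U x| ^ r) ρ := hUp.integrable_norm_rpow hp0 hpt
    have ig : ∀ {F : X → ℝ}, Integrable F ρ → Integrable (fun x => g x * F x) ρ := fun hF =>
      hF.bdd_mul hgm.aestronglyMeasurable (Eventually.of_forall hgM)
    have hineq : ∀ n, (∫ x, |U x| ^ r ∂ρ) + ((∫ x, g x * W n x ∂ρ) - ∫ x, g x * U x ∂ρ)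
        ≤ (C : ℝ) ^ r := by
      intro n
      refine le_trans ?_ ((key _ (hWp n)).1 (hLp n))
      have i1 := ig (hint n)
      have i2 : Integrable (fun x => g x * U x) ρ := ig (hV.indicator hBm)
      have i3 : Integrable (fun x => g x * W n x - g x * U x) ρ := i1.sub i2
      rw [← integral_sub i1 i2, ← integral_add iU i3]
      refine integral_mono (iU.add i3) (hWi n) fun x => ?_
      have := tangent_aux r hr1 (U x) (W n x)
      simp only [hg]
      linarith
    have hl2 := (hlim.sub_const (∫ x, g x * U x ∂ρ)).const_add (∫ x, |U x| ^ r ∂ρ)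
    have := le_of_tendsto hl2 (Eventually.of_forall hineq)
    simpa using this

theorem cutNorm_complete_L1_Lp_bounded {S : Type*} [MeasurableSpace S]
    (μ : Measure S) [SigmaFinite μ]
    (p : ENNReal) (hp : 1 < p) (C C₁ : NNReal)
    (W : ℕ → S × S → ℝ)
    (hsymm : ∀ n x y, W n (x, y) = W n (y, x))
    (hint : ∀ n, Integrable (W n) (μ.prod μ))
    (hLp : ∀ n, eLpNorm (W n) p (μ.prod μ) ≤ C)
    (hL1 : ∀ n, eLpNorm (W n) 1 (μ.prod μ) ≤ C₁)
    (hcauchy : ∀ ε > (0:ℝ), ∃ N, ∀ m ≥ N, ∀ n ≥ N,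
      cutNorm μ (fun q => W m q - W n q) < ε) :
    ∃ V : S × S → ℝ, (∀ x y, V (x, y) = V (y, x)) ∧ Integrable V (μ.prod μ) ∧
      eLpNorm V p (μ.prod μ) ≤ C ∧ eLpNorm V 1 (μ.prod μ) ≤ C₁ ∧
      Tendsto (fun n => cutNorm μ (fun q => W n q - V q)) atTop (𝓝 0) := by
  classical
  set ρ : Measure (S × S) := μ.prod μ with hρ
  have hcutle : ∀ F : S × S → ℝ, Integrable F ρ → ∀ T U : Set S, MeasurableSet T →
      MeasurableSet U → |∫ q in T ×ˢ U, F q ∂ρ| ≤ cutNorm μ F := by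
    intro F hF T U hT hU
    have hb : BddAbove (Set.range
        (fun TU : {TU : Set S × Set S // MeasurableSet TU.1 ∧ MeasurableSet TU.2} =>
        |∫ p in TU.1.1 ×ˢ TU.1.2, F p ∂(μ.prod μ)|)) := by
      refine ⟨∫ q, |F q| ∂ρ, ?_⟩
      rintro _ ⟨TU, rfl⟩
      refine (abs_integral_le_integral_abs).trans ?_
      exact setIntegral_le_integral hF.abs (Eventually.of_forall fun x => abs_nonneg _)
    exact le_ciSup hb ⟨(T, U), hT, hU⟩
  have hcut : ∀ ε > (0:ℝ), ∃ N, ∀ m ≥ N, ∀ n ≥ N, ∀ T U : Set S, MeasurableSet T →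
      MeasurableSet U → |(∫ q in T ×ˢ U, W m q ∂ρ) - ∫ q in T ×ˢ U, W n q ∂ρ| ≤ ε := by
    intro ε hε
    obtain ⟨N, hN⟩ := hcauchy ε hε
    refine ⟨N, fun m hm n hn T U hT hU => ?_⟩
    rw [← integral_sub (hint m).integrableOn (hint n).integrableOn]
    exact (hcutle _ ((hint m).sub (hint n)) T U hT hU).trans (hN m hm n hn).le
  have hrect : ∀ T U : Set S, MeasurableSet T → MeasurableSet U →
      CauchySeq (fun n => ∫ q in T ×ˢ U, W n q ∂ρ) := by
    intro T U hT hU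
    rw [Metric.cauchySeq_iff']
    intro ε hε
    obtain ⟨N, hN⟩ := hcut (ε / 2) (by linarith)
    refine ⟨N, fun n hn => ?_⟩
    rw [Real.dist_eq]
    linarith [hN n hn N le_rfl T U hT hU]
  have hL1' : ∀ n, ∫ q, |W n q| ∂ρ ≤ C₁ := by
    intro n
    have h := hL1 n
    rw [eLpNorm_one_eq_lintegral_enorm, ← ofReal_integral_norm_eq_lintegral_enorm (hint n),
      ← ENNReal.ofReal_coe_nnreal, ENNReal.ofReal_le_ofReal_iff C₁.coe_nonneg] at h
    exact h
  -- the pieces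
  set idx : S → ℕ := spanningSetsIndex μ with hidx
  have hidxm : Measurable idx := measurableSet_spanningSetsIndex μ
  set D : ℕ → Set S := fun i => idx ⁻¹' {i} with hD
  have hDm : ∀ i, MeasurableSet (D i) := fun i => hidxm (measurableSet_singleton i)
  have hDfin : ∀ i, μ (D i) < ⊤ := by
    intro i
    refine (measure_mono ?_).trans_lt (measure_spanningSets_lt_top μ i)
    intro x hx
    have : idx x = i := hx
    rw [← this]
    exact mem_spanningSetsIndex μ x
  set E : ℕ × ℕ → Set (S × S) := fun k => D k.1 ×ˢ D k.2 with hE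
  have hEm : ∀ k, MeasurableSet (E k) := fun k => (hDm _).prod (hDm _)
  have hEfin : ∀ k, ρ (E k) < ⊤ := by
    intro k
    rw [hρ, hE, Measure.prod_prod]
    exact ENNReal.mul_lt_top (hDfin _) (hDfin _)
  have hpiece : ∀ k, ∃ V : S × S → ℝ, Measurable V ∧ Integrable V (ρ.restrict (E k)) ∧
      ∀ A, MeasurableSet A → Tendsto (fun n => ∫ x in A, W n x ∂(ρ.restrict (E k))) atTop
        (𝓝 (∫ x in A, V x ∂(ρ.restrict (E k)))) := by
    intro k
    have : IsFiniteMeasure (ρ.restrict (E k)) := ⟨by simpa using hEfin k⟩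
    refine weak_limit_aux (ρ.restrict (E k)) W (fun n => (hint n).restrict)
      (fun ε hε => ui_aux _ p hp C W (fun n => (hint n).restrict)
        (fun n => (eLpNorm_restrict_le _ _ _ _).trans (hLp n)) ε hε)
      (Set.image2 (· ×ˢ ·) {s : Set S | MeasurableSet s} {t : Set S | MeasurableSet t})
      generateFrom_prod.symm isPiSystem_prod
      ⟨Set.univ, MeasurableSet.univ, Set.univ, MeasurableSet.univ, Set.univ_prod_univ⟩ ?_
    rintro _ ⟨T, hT, U, hU, rfl⟩
    have hT : MeasurableSet T := hT
    have hU : MeasurableSet U := hU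
    simp only [Measure.restrict_restrict (hT.prod hU), hE, Set.prod_inter_prod]
    exact hrect _ _ (hT.inter (hDm _)) (hU.inter (hDm _))
  choose V0 hV0m hV0i hV0 using hpiece
  set V : S × S → ℝ := fun q => V0 (idx q.1, idx q.2) q with hV
  have hVm : Measurable V := by
    have h1 : Measurable (fun z : (ℕ × ℕ) × (S × S) => V0 z.1 z.2) :=
      measurable_from_prod_countable_right hV0m
    have h2 : Measurable (fun q : S × S => ((idx q.1, idx q.2), q)) := by fun_prop
    exact h1.comp h2
  have hVE : ∀ k, ∀ q ∈ E k, V0 k q = V q := by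
    rintro ⟨i, j⟩ ⟨x, y⟩ ⟨hx, hy⟩
    have hx : idx x = i := hx
    have hy : idx y = j := hy
    simp [hV, hx, hy]
  have hVEi : ∀ k, IntegrableOn V (E k) ρ := fun k =>
    IntegrableOn.congr_fun (hV0i k) (hVE k) (hEm k)
  have hconvE : ∀ k A, MeasurableSet A → Tendsto (fun n => ∫ x in A ∩ E k, W n x ∂ρ) atTop
        (𝓝 (∫ x in A ∩ E k, V x ∂ρ)) := by
    intro k A hA
    have h := hV0 k A hA
    simp only [Measure.restrict_restrict hA] at h
    rwa [setIntegral_congr_fun (hA.inter (hEm k)) fun q hq => hVE k q hq.2] at h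
  set F : ℕ → Set S := fun K => {x | idx x < K} with hF
  have hFm : ∀ K, MeasurableSet (F K) := fun K => hidxm (measurableSet_Iio (a := K))
  set B : ℕ → Set (S × S) := fun K => F K ×ˢ F K with hB
  have hBm : ∀ K, MeasurableSet (B K) := fun K => (hFm K).prod (hFm K)
  have hBE : ∀ K, B K = ⋃ k ∈ Finset.range K ×ˢ Finset.range K, E k := by
    intro K
    ext ⟨x, y⟩
    simp [hB, hE, hF, hD]
  have hBfin : ∀ K, ρ (B K) < ⊤ := by
    intro K
    rw [hBE K]
    exact (measure_biUnion_finset_le _ _).trans_lt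
      (ENNReal.sum_lt_top.2 fun k _ => hEfin k)
  have hBi : ∀ K, IntegrableOn V (B K) ρ := by
    intro K
    rw [hBE K]
    exact integrableOn_finset_iUnion.2 fun k _ => hVEi k
  have hEd : ∀ k l, k ≠ l → Disjoint (E k) (E l) := by
    rintro ⟨i, j⟩ ⟨i', j'⟩ hkl
    rw [Set.disjoint_left]
    rintro ⟨x, y⟩ ⟨h1, h2⟩ ⟨h3, h4⟩
    have h1 : idx x = i := h1
    have h2 : idx y = j := h2
    have h3 : idx x = i' := h3
    have h4 : idx y = j' := h4
    exact hkl (by rw [← h1, ← h2, ← h3, ← h4])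
  have hconvB : ∀ K A, MeasurableSet A → Tendsto (fun n => ∫ x in A ∩ B K, W n x ∂ρ) atTop
        (𝓝 (∫ x in A ∩ B K, V x ∂ρ)) := by
    intro K A hA
    have hsplit : ∀ G : S × S → ℝ, IntegrableOn G (B K) ρ → ∫ x in A ∩ B K, G x ∂ρ =
        ∑ k ∈ Finset.range K ×ˢ Finset.range K, ∫ x in A ∩ E k, G x ∂ρ := by
      intro G hG
      rw [hBE K, Set.inter_iUnion₂]
      refine integral_biUnion_finset _ (fun k _ => hA.inter (hEm k)) ?_ ?_
      · intro k _ l _ hkl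
        exact (hEd k l hkl).mono Set.inter_subset_right Set.inter_subset_right
      · intro k hk
        refine hG.mono_set (Set.inter_subset_right.trans ?_)
        rw [hBE K]
        exact Set.subset_biUnion_of_mem (u := E) hk
    simp_rw [fun n => hsplit (W n) (hint n).integrableOn]
    rw [hsplit V (hBi K)]
    exact tendsto_finsetSum _ fun k _ => hconvE k A hA
  have hBex : ∀ q, ∃ N, ∀ n ≥ N, q ∈ B n := by
    rintro ⟨x, y⟩
    refine ⟨max (idx x) (idx y) + 1, fun n hn => ⟨?_, ?_⟩⟩
    · exact lt_of_lt_of_le (Nat.lt_succ_of_le (le_max_left _ _)) hn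
    · exact lt_of_lt_of_le (Nat.lt_succ_of_le (le_max_right _ _)) hn
  -- norm bounds
  have hnorm : ∀ (r : ENNReal) (c : NNReal), 1 ≤ r → (∀ n, eLpNorm (W n) r ρ ≤ c) →
      eLpNorm V r ρ ≤ c := by
    intro r c hr hc
    refine liminf_le_aux ρ r c V hVm B hBm hBex fun K => ?_
    have : IsFiniteMeasure (ρ.restrict (B K)) := ⟨by simpa using hBfin K⟩
    refine norm_aux (ρ.restrict (B K)) r hr c W (fun n => (hint n).restrict) C₁ (fun n => ?_)
      (fun n => (eLpNorm_restrict_le _ _ _ _).trans (hc n)) V hVm (hBi K) (fun A hA => ?_)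
    · exact (setIntegral_le_integral (hint n).abs
        (Eventually.of_forall fun x => abs_nonneg _)).trans (hL1' n)
    · simp only [Measure.restrict_restrict hA]
      exact hconvB K A hA
  have hVp := hnorm p C hp.le hLp
  have hV1 := hnorm 1 C₁ le_rfl hL1
  have hVi : Integrable V ρ :=
    memLp_one_iff_integrable.1 ⟨hVm.aestronglyMeasurable, hV1.trans_lt (by simp)⟩
  -- uniform convergence on rectangles
  have hunif : ∀ ε > (0:ℝ), ∃ N, ∀ n ≥ N, ∀ T U : Set S, MeasurableSet T →
      MeasurableSet U → |(∫ q in T ×ˢ U, W n q ∂ρ) - ∫ q in T ×ˢ U, V q ∂ρ| ≤ ε := by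
    intro ε hε
    obtain ⟨N, hN⟩ := hcut ε hε
    refine ⟨N, fun n hn T U hT hU => ?_⟩
    have hK : ∀ K, |(∫ q in (T ×ˢ U) ∩ B K, W n q ∂ρ) - ∫ q in (T ×ˢ U) ∩ B K, V q ∂ρ| ≤ ε := by
      intro K
      have h1 := ((hconvB K _ (hT.prod hU)).const_sub (∫ q in (T ×ˢ U) ∩ B K, W n q ∂ρ)).abs
      refine le_of_tendsto h1 ?_
      filter_upwards [eventually_ge_atTop N] with m hm
      simp only [hB, Set.prod_inter_prod]
      exact hN n hn m hm _ _ (hT.inter (hFm K)) (hU.inter (hFm K))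
    have hFmono : Monotone F := fun K L hKL x hx => lt_of_lt_of_le hx hKL
    have hlimK : ∀ G : S × S → ℝ, Integrable G ρ →
        Tendsto (fun K => ∫ q in (T ×ˢ U) ∩ B K, G q ∂ρ) atTop (𝓝 (∫ q in T ×ˢ U, G q ∂ρ)) := by
      intro G hG
      have h := tendsto_setIntegral_of_monotone (μ := ρ) (f := G) (s := fun K => (T ×ˢ U) ∩ B K)
        (fun K => (hT.prod hU).inter (hBm K))
        (fun K L hKL => Set.inter_subset_inter_right _
          (Set.prod_mono (hFmono hKL) (hFmono hKL))) hG.integrableOn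
      have hun : (⋃ K, (T ×ˢ U) ∩ B K) = T ×ˢ U := by
        rw [← Set.inter_iUnion]
        refine Set.inter_eq_left.2 fun q _ => ?_
        obtain ⟨M, hM⟩ := hBex q
        exact Set.mem_iUnion.2 ⟨M, hM M le_rfl⟩
      rwa [hun] at h
    exact le_of_tendsto ((hlimK _ (hint n)).sub (hlimK _ hVi)).abs (Eventually.of_forall hK)
  clear_value V
  -- symmetrization
  have hsw : MeasurePreserving (Prod.swap : S × S → S × S) ρ ρ := Measure.measurePreserving_swap
  have hVsi : Integrable (fun q : S × S => V q.swap) ρ := hsw.integrable_comp_of_integrable hVi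
  have hVsm : Measurable (fun q : S × S => V q.swap) := hVm.comp measurable_swap
  have hsn : ∀ (r : ENNReal) (c : NNReal), 1 ≤ r → eLpNorm V r ρ ≤ c →
      eLpNorm (fun q : S × S => (1 / 2 : ℝ) * (V q + V q.swap)) r ρ ≤ c := by
    intro r c hr h
    have h1 : eLpNorm (fun q : S × S => V q.swap) r ρ = eLpNorm V r ρ :=
      eLpNorm_comp_measurePreserving (g := V) (f := Prod.swap) hVm.aestronglyMeasurable hsw
    have h2 : eLpNorm (V + fun q : S × S => V q.swap) r ρ ≤ c + c := by
      refine (eLpNorm_add_le hVm.aestronglyMeasurable hVsm.aestronglyMeasurable hr).trans ?_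
      rw [h1]
      gcongr
    have h3 := eLpNorm_const_smul (1 / 2 : ℝ) (V + fun q : S × S => V q.swap) r ρ
    have h4 : (fun q : S × S => (1 / 2 : ℝ) * (V q + V q.swap))
        = (1 / 2 : ℝ) • (V + fun q : S × S => V q.swap) := by
      funext q; simp
    rw [h4, h3]
    have h5 : ‖(1 / 2 : ℝ)‖ₑ = (2 : ENNReal)⁻¹ := by
      rw [← ofReal_norm, Real.norm_of_nonneg (by norm_num), one_div,
        ENNReal.ofReal_inv_of_pos (by norm_num)]
      simp
    rw [h5]
    calc (2 : ENNReal)⁻¹ * _ ≤ 2⁻¹ * ((c : ENNReal) + c) := by gcongr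
      _ = c := by
        rw [← two_mul, ← mul_assoc, ENNReal.inv_mul_cancel (by simp) (by simp), one_mul]
  have hswint : ∀ (G : S × S → ℝ) (T U : Set S),
      ∫ q in T ×ˢ U, G q.swap ∂ρ = ∫ q in U ×ˢ T, G q ∂ρ := by
    intro G T U
    have := hsw.setIntegral_preimage_emb (MeasurableEquiv.prodComm.measurableEmbedding) G (U ×ˢ T)
    rw [Set.preimage_swap_prod] at this
    exact this
  have hV'i : Integrable (fun q : S × S => (1 / 2 : ℝ) * (V q + V q.swap)) ρ :=
    (hVi.add hVsi).const_mul _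
  refine ⟨fun q => (1 / 2 : ℝ) * (V q + V q.swap), fun x y => ?_, hV'i, hsn p C hp.le hVp,
    hsn 1 C₁ le_rfl hV1, ?_⟩
  · simp only [Prod.swap_prod_mk]; ring
  rw [Metric.tendsto_atTop]
  intro ε hε
  obtain ⟨N, hN⟩ := hunif (ε / 2) (by linarith)
  refine ⟨N, fun n hn => ?_⟩
  have hle : cutNorm μ (fun q => W n q - (1 / 2 : ℝ) * (V q + V q.swap)) ≤ ε / 2 := by
    have : Nonempty {TU : Set S × Set S // MeasurableSet TU.1 ∧ MeasurableSet TU.2} :=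
      ⟨⟨(∅, ∅), MeasurableSet.empty, MeasurableSet.empty⟩⟩
    refine ciSup_le ?_
    rintro ⟨⟨T, U⟩, hT, hU⟩
    have hT : MeasurableSet T := hT
    have hU : MeasurableSet U := hU
    change |∫ q in T ×ˢ U, (W n q - (1 / 2 : ℝ) * (V q + V q.swap)) ∂ρ| ≤ ε / 2
    rw [integral_sub (hint n).integrableOn hV'i.integrableOn, integral_const_mul,
      integral_add hVi.integrableOn hVsi.integrableOn, hswint V T U]
    have hWs : ∫ q in T ×ˢ U, W n q ∂ρ = ∫ q in U ×ˢ T, W n q ∂ρ := by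
      rw [← hswint (W n) T U]
      refine integral_congr_ae (Eventually.of_forall fun q => ?_)
      exact hsymm n q.1 q.2
    have a1 := abs_le.1 (hN n hn T U hT hU)
    have a2 := abs_le.1 (hN n hn U T hU hT)
    rw [abs_le]
    constructor <;> linarith
  have h0 : 0 ≤ cutNorm μ (fun q => W n q - (1 / 2 : ℝ) * (V q + V q.swap)) :=
    Real.iSup_nonneg fun _ => abs_nonneg _
  rw [Real.dist_eq, sub_zero, abs_of_nonneg h0]
  linarith
end
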